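/- arXiv:0706.2901 — 4 statements merged into one kernel-verified Lean document; each statement's English description precedes it below -/
import Mathlib

section
/- Let n ≥ 1 and let F be an n×n real matrix. There exist an n×n real matrix H of rank 1 and a real number α₁ < 0 such that F + αH is Hurwitz for every real α ≤ α₁ if, and only if, every complex eigenvalue λ of F with Re(λ) ≥ 0 has geometric multiplicity 1 (i.e., the complex kernel of F − λI is one-dimensional, so λ corresponds to exactly one Jordan block). -/
open Matrix

/-- A real square matrix is Hurwitz (stable) if every complex eigenvalue has
negative real part. -/
def IsHurwitz {n : ℕ} (M : Matrix (Fin n) (Fin n) ℝ) : Prop :=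
  ∀ μ : ℂ, Module.End.HasEigenvalue
    (Matrix.toLin' (M.map (Complex.ofReal : ℝ → ℂ))) μ → μ.re < 0

/-- The geometric multiplicity of `μ` as a (complex) eigenvalue of the real matrix `F`:
the dimension over `ℂ` of the kernel of `F - μ I`. -/
noncomputable def geomMult {n : ℕ} (F : Matrix (Fin n) (Fin n) ℝ) (μ : ℂ) : ℕ :=
  Module.finrank ℂ (Module.End.eigenspace
    (Matrix.toLin' (F.map (Complex.ofReal : ℝ → ℂ))) μ)

open Polynomial in
/-- An endomorphism of a finite-dimensional space admits a vector whose annihilating polynomials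
are the multiples of the minimal polynomial. -/
theorem exists_minpoly_dvd_of_aeval_apply_eq_zero {K V : Type*} [Field K] [AddCommGroup V]
    [Module K V] [FiniteDimensional K V] (f : Module.End K V) :
    ∃ v : V, ∀ p : K[X], aeval f p v = 0 → minpoly K f ∣ p := by
  obtain ⟨x, hx⟩ := Module.exists_ker_toSpanSingleton_eq_annihilator K[X] (Module.AEval' f)
  refine ⟨(Module.AEval'.of f).symm x, fun p hp ↦ ?_⟩
  rw [← Ideal.mem_span_singleton, span_minpoly_eq_annihilator, ← hx, LinearMap.mem_ker,
    LinearMap.toSpanSingleton_apply]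
  apply (Module.AEval'.of f).symm.injective
  rw [map_zero]
  exact (Module.AEval.of_symm_smul (a := f) p x).trans hp

open Polynomial in
/-- Some orbit and functional read off the top coefficient of polynomials of degree smaller than
that of the minimal polynomial. -/
theorem exists_functional_pow_apply_eq_ite {K V : Type*} [Field K] [AddCommGroup V]
    [Module K V] [FiniteDimensional K V] [Nontrivial V] (f : Module.End K V) :
    ∃ (v : V) (φ : V →ₗ[K] K), ∀ i < (minpoly K f).natDegree,
      φ ((f ^ i) v) = if i = (minpoly K f).natDegree - 1 then 1 else 0 := by
  obtain ⟨v, hv⟩ := exists_minpoly_dvd_of_aeval_apply_eq_zero f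
  have hpos : 0 < (minpoly K f).natDegree :=
    minpoly.natDegree_pos (Algebra.IsIntegral.isIntegral f)
  set d := (minpoly K f).natDegree
  let L : K[X] →ₗ[K] V := (LinearMap.applyₗ v).comp (aeval f).toLinearMap
  have hnot : (f ^ (d - 1)) v ∉ (degreeLT K (d - 1)).map L := by
    rintro ⟨p, hp, hpv⟩
    have hp' : p.degree < ((d - 1 : ℕ) : WithBot ℕ) := mem_degreeLT.mp hp
    have hdeg : (X ^ (d - 1) - p).degree = ((d - 1 : ℕ) : WithBot ℕ) := by
      rw [degree_sub_eq_left_of_degree_lt (by rwa [degree_X_pow]), degree_X_pow]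
    have hdvd := hv (X ^ (d - 1) - p) (by
      have : aeval f p v = (f ^ (d - 1)) v := hpv
      simp [this])
    have hne : X ^ (d - 1) - p ≠ 0 := by
      intro h
      simp [h] at hdeg
    have := natDegree_le_of_dvd hdvd hne
    rw [natDegree_eq_of_degree_eq_some hdeg] at this
    omega
  obtain ⟨φ, hφ, hle⟩ := Submodule.exists_le_ker_of_notMem hnot
  refine ⟨v, (φ ((f ^ (d - 1)) v))⁻¹ • φ, fun i hi ↦ ?_⟩
  split_ifs with h
  · subst h
    simp [hφ]
  · have : φ ((f ^ i) v) = 0 := hle ⟨X ^ i, by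
      rw [SetLike.mem_coe, mem_degreeLT, degree_X_pow]
      exact_mod_cast (by omega : i < d - 1), by simp [L]⟩
    simp [this]

open Polynomial in
/-- A functional that picks out the `(d - 1)`-st vector of an orbit reads off the coefficient of
degree `d - 1` of polynomials of degree less than `d`. -/
theorem functional_aeval_apply_eq_coeff {K V : Type*} [Field K] [AddCommGroup V] [Module K V]
    (g : Module.End K V) (b : V) (φ : V →ₗ[K] K) {d : ℕ} (hd : 0 < d)
    (hφ : ∀ i < d, φ ((g ^ i) b) = if i = d - 1 then 1 else 0) (p : K[X]) (hp : p.natDegree < d) :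
    φ (aeval g p b) = p.coeff (d - 1) := by
  rw [aeval_eq_sum_range' hp, LinearMap.sum_apply, map_sum,
    Finset.sum_congr rfl fun i hi ↦ by
      rw [LinearMap.smul_apply, map_smul, hφ i (Finset.mem_range.mp hi)]]
  simp [hd]

open Polynomial in
/-- An eigenvalue `τ` of the rank-one perturbation `v ↦ g v - k φ(v) gᵈ⁻¹ b` which is not a
multiple eigenvalue of `g` satisfies `P(τ) + k τᵈ⁻¹ = 0`, where `P` of degree `d` annihilates `g`
and `φ` reads off the coefficient of degree `d - 1` along the orbit of `b`. -/
theorem eval_add_mul_pow_eq_zero_of_eigenvector {K V : Type*} [Field K] [AddCommGroup V]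
    [Module K V] (g : Module.End K V) (b : V) (φ : V →ₗ[K] K) {P : K[X]} (hP : P.Monic)
    (hpos : 0 < P.natDegree) (hPg : aeval g P = 0)
    (hφ : ∀ i < P.natDegree, φ ((g ^ i) b) = if i = P.natDegree - 1 then 1 else 0)
    {k τ : K} {v : V} (hv0 : v ≠ 0)
    (hv : g v - (k * φ v) • (g ^ (P.natDegree - 1)) b = τ • v)
    (hone : g.HasEigenvalue τ → Module.finrank K (g.eigenspace τ) = 1) :
    P.eval τ + k * τ ^ (P.natDegree - 1) = 0 := by
  set d := P.natDegree
  set r := P /ₘ (X - C τ) with hr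
  set s := (X ^ (d - 1) : K[X]) /ₘ (X - C τ) with hs
  have hrP : (X - C τ) * r = P - C (P.eval τ) := by
    have := modByMonic_add_div P (X - C τ)
    rw [modByMonic_X_sub_C_eq_C_eval] at this
    exact eq_sub_of_add_eq' this
  have hsX : (X - C τ) * s = X ^ (d - 1) - C (τ ^ (d - 1)) := by
    have := modByMonic_add_div (X ^ (d - 1)) (X - C τ)
    rw [modByMonic_X_sub_C_eq_C_eval, eval_pow, eval_X] at this
    exact eq_sub_of_add_eq' this
  have hrdeg : r.natDegree = d - 1 := by
    rw [hr, natDegree_divByMonic _ (monic_X_sub_C τ), natDegree_X_sub_C]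
  have hrb : φ (aeval g r b) = 1 := by
    rw [functional_aeval_apply_eq_coeff g b φ hpos hφ r (by omega), ← hrdeg, coeff_natDegree, hr,
      leadingCoeff_divByMonic_X_sub_C P (by
        rw [degree_eq_natDegree hP.ne_zero]; exact_mod_cast hpos.ne') τ]
    exact hP
  have hsdeg : s.degree < ((d - 1 : ℕ) : WithBot ℕ) := by
    rw [hs, ← degree_X_pow (R := K) (d - 1)]
    exact degree_divByMonic_lt _ _ (pow_ne_zero _ X_ne_zero) (by simp)
  have hsb : φ (aeval g s b) = 0 := by
    rw [functional_aeval_apply_eq_coeff g b φ hpos hφ s ?_, coeff_eq_zero_of_degree_lt hsdeg]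
    by_cases h0 : s = 0
    · simp [h0, hpos]
    · have := (natDegree_lt_iff_degree_lt h0).mpr hsdeg
      omega
  have hrs : r * X ^ (d - 1) = C (τ ^ (d - 1)) * r + P * s - C (P.eval τ) * s := by
    linear_combination s * hrP - r * hsX
  have hrXb : φ (aeval g r ((g ^ (d - 1)) b)) = τ ^ (d - 1) := by
    have h := congrArg (fun p ↦ φ (aeval g p b)) hrs
    simpa only [map_sub, map_add, map_mul, aeval_X_pow, aeval_C, hPg, zero_mul, add_zero,
      LinearMap.sub_apply, LinearMap.add_apply, Module.End.mul_apply,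
      Module.algebraMap_end_apply, map_smul, hrb, hsb, sub_zero, smul_eq_mul,
      mul_one, mul_zero] using h
  have hrg : ∀ w, aeval g r (g w - τ • w) = -P.eval τ • w := by
    intro w
    have h := congrArg (fun p ↦ aeval g p w) ((mul_comm r _).trans hrP)
    simpa [hPg, Module.algebraMap_end_apply] using h
  have hgr : ∀ w, g (aeval g r w) - τ • aeval g r w = -P.eval τ • w := by
    intro w
    have h := congrArg (fun p ↦ aeval g p w) hrP
    simpa [hPg, Module.algebraMap_end_apply] using h
  have key : (k * φ v) • aeval g r ((g ^ (d - 1)) b) = -P.eval τ • v := by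
    rw [← hrg v, ← map_smul, ← hv]
    congr 1
    abel
  have keyφ : φ v * (P.eval τ + k * τ ^ (d - 1)) = 0 := by
    have h := congrArg φ key
    rw [map_smul, map_smul, hrXb, smul_eq_mul, smul_eq_mul] at h
    linear_combination h
  refine (mul_eq_zero.mp keyφ).resolve_left fun hφv ↦ ?_
  have hP0 : P.eval τ = 0 := by
    simpa [hφv, hv0] using key
  have hgv : g v = τ • v := by simpa [hφv] using hv
  have hvmem : v ∈ g.eigenspace τ := Module.End.mem_eigenspace_iff.mpr hgv
  have hwmem : aeval g r b ∈ g.eigenspace τ :=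
    Module.End.mem_eigenspace_iff.mpr (sub_eq_zero.mp (by simpa [hP0] using hgr b))
  obtain ⟨a, ha⟩ := (finrank_eq_one_iff_of_nonzero' (⟨v, hvmem⟩ : g.eigenspace τ)
    (by simpa using hv0)).mp
    (hone (Module.End.hasEigenvalue_of_hasEigenvector ⟨hvmem, hv0⟩)) ⟨_, hwmem⟩
  have hav : a • v = aeval g r b := congrArg Subtype.val ha
  rw [← hav, map_smul, hφv, smul_zero] at hrb
  exact zero_ne_one hrb

open Polynomial in
/-- For large `k`, the polynomial `P + k Xᵈ⁻¹` with `P` monic of degree `d` has no roots of real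
part at least one. -/
theorem exists_forall_eval_add_mul_pow_ne_zero {P : ℂ[X]} (hP : P.Monic)
    (hpos : 0 < P.natDegree) :
    ∃ k₀ : ℝ, 0 < k₀ ∧ ∀ k : ℝ, k₀ ≤ k → ∀ τ : ℂ, 1 ≤ τ.re →
      P.eval τ + k * τ ^ (P.natDegree - 1) ≠ 0 := by
  obtain ⟨e, he⟩ : ∃ e, P.natDegree = e + 1 := ⟨_, (Nat.succ_pred_eq_of_pos hpos).symm⟩
  refine ⟨∑ i ∈ Finset.range (e + 1), ‖P.coeff i‖ + 1, by positivity, fun k hk τ hτ h ↦ ?_⟩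
  have hτ1 : 1 ≤ ‖τ‖ := hτ.trans (Complex.re_le_norm τ)
  have heval : P.eval τ = τ ^ (e + 1) + ∑ i ∈ Finset.range (e + 1), P.coeff i * τ ^ i := by
    rw [eval_eq_sum_range, he, Finset.sum_range_succ, ← he, hP.coeff_natDegree]
    ring
  have hsum : (τ + k) * τ ^ e = -∑ i ∈ Finset.range (e + 1), P.coeff i * τ ^ i := by
    rw [heval, he, Nat.add_sub_cancel] at h
    linear_combination h
  have hle : ‖τ + k‖ * ‖τ‖ ^ e ≤ (∑ i ∈ Finset.range (e + 1), ‖P.coeff i‖) * ‖τ‖ ^ e := by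
    rw [← norm_pow, ← norm_mul, hsum, norm_neg, Finset.sum_mul]
    refine norm_sum_le_of_le _ fun i hi ↦ ?_
    rw [norm_mul, norm_pow, norm_pow]
    have : i ≤ e := Nat.lt_succ_iff.mp (Finset.mem_range.mp hi)
    gcongr
  have hle' := le_of_mul_le_mul_right hle (by positivity)
  have hre := Complex.re_le_norm (τ + k)
  rw [Complex.add_re, Complex.ofReal_re] at hre
  linarith

/-- A matrix of rank one is an outer product. -/
theorem exists_eq_vecMulVec_of_rank_eq_one {K m n : Type*} [Field K] [Fintype n] [DecidableEq n]
    {H : Matrix m n K} (hH : H.rank = 1) :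
    ∃ (b : m → K) (c : n → K), H = vecMulVec b c := by
  obtain ⟨b, -, hb⟩ := finrank_eq_one_iff'.mp hH
  choose c hc using fun j ↦ hb ⟨H *ᵥ Pi.single j 1, ⟨_, rfl⟩⟩
  refine ⟨b, c, ?_⟩
  ext i j
  have h : c j • (b : m → K) = H *ᵥ Pi.single j 1 := congrArg Subtype.val (hc j)
  have h' := congrFun h i
  simp only [Pi.smul_apply, smul_eq_mul, mulVec_single_one, col_apply] at h'
  rw [vecMulVec_apply, mul_comm, h']

theorem rank_vecMulVec_eq_one {K m n : Type*} [Field K] [Fintype n] [DecidableEq n]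
    {b : m → K} {c : n → K} (hb : b ≠ 0) (hc : c ≠ 0) : (vecMulVec b c).rank = 1 := by
  refine le_antisymm (rank_vecMulVec_le b c) (Nat.one_le_iff_ne_zero.mpr fun h ↦ ?_)
  obtain ⟨i, hi⟩ := Function.ne_iff.mp hb
  obtain ⟨j, hj⟩ := Function.ne_iff.mp hc
  have hbot : LinearMap.range (vecMulVec b c).mulVecLin = ⊥ := Submodule.finrank_eq_zero.mp h
  have h0 := LinearMap.congr_fun (LinearMap.range_eq_bot.mp hbot) (Pi.single j 1)
  have h1 := congrFun h0 i
  simp [vecMulVec_apply] at h1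
  tauto

theorem map_ofReal_add_smul_vecMulVec_mulVec {n : ℕ} (F : Matrix (Fin n) (Fin n) ℝ)
    (b c : Fin n → ℝ) (α : ℝ) (v : Fin n → ℂ) :
    (F + α • vecMulVec b c).map Complex.ofReal *ᵥ v =
      F.map Complex.ofReal *ᵥ v +
        (α * ((Complex.ofReal ∘ c) ⬝ᵥ v)) • (Complex.ofReal ∘ b) := by
  have h : (F + α • vecMulVec b c).map Complex.ofReal =
      F.map Complex.ofReal +
        (α : ℂ) • vecMulVec (Complex.ofReal ∘ b) (Complex.ofReal ∘ c) := by
    ext i j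
    simp [vecMulVec_apply]
  rw [h, add_mulVec, smul_mulVec, vecMulVec_mulVec, op_smul_eq_smul, smul_smul]

/-- An eigenvalue of `F` in the closed right half-plane that is removed by a rank-one perturbation
has geometric multiplicity one. -/
theorem geomMult_eq_one_of_isHurwitz_add_smul {n : ℕ} {F H : Matrix (Fin n) (Fin n) ℝ}
    (hH : H.rank = 1) {α : ℝ} (hα : IsHurwitz (F + α • H)) {μ : ℂ}
    (hμ : Module.End.HasEigenvalue (Matrix.toLin' (F.map (Complex.ofReal : ℝ → ℂ))) μ)
    (hre : 0 ≤ μ.re) : geomMult F μ = 1 := by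
  obtain ⟨b, c, rfl⟩ := exists_eq_vecMulVec_of_rank_eq_one hH
  have hpos : 0 < geomMult F μ := Submodule.one_le_finrank_iff.mpr hμ
  by_contra hne
  let ψ : Module.End.eigenspace (Matrix.toLin' (F.map (Complex.ofReal : ℝ → ℂ))) μ →ₗ[ℂ] ℂ :=
    (dotProductBilin ℂ ℂ (Complex.ofReal ∘ c)).domRestrict _
  have hker : LinearMap.ker ψ ≠ ⊥ := LinearMap.ker_ne_bot_of_finrank_lt (by
    rw [Module.finrank_self]
    change 1 < geomMult F μ
    omega)
  obtain ⟨v, hv, hv0⟩ := (Submodule.ne_bot_iff _).mp hker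
  have hcv : (Complex.ofReal ∘ c) ⬝ᵥ (v : Fin n → ℂ) = 0 := hv
  refine hre.not_gt (hα μ (Module.End.hasEigenvalue_of_hasEigenvector (x := v)
    ⟨Module.End.mem_eigenspace_iff.mpr ?_, by simpa using hv0⟩))
  rw [toLin'_apply, map_ofReal_add_smul_vecMulVec_mulVec, hcv, mul_zero, zero_smul, add_zero]
  exact Module.End.mem_eigenspace_iff.mp v.2

/-- If the eigenvalues of `F` in the closed right half-plane have geometric multiplicity one, then
some rank-one perturbation stabilizes `F` for all sufficiently negative gains. -/
theorem exists_rank_one_forall_isHurwitz {n : ℕ} (hn : 1 ≤ n) (F : Matrix (Fin n) (Fin n) ℝ)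
    (hF : ∀ μ : ℂ,
      Module.End.HasEigenvalue (Matrix.toLin' (F.map (Complex.ofReal : ℝ → ℂ))) μ →
        0 ≤ μ.re → geomMult F μ = 1) :
    ∃ (H : Matrix (Fin n) (Fin n) ℝ) (α₁ : ℝ), H.rank = 1 ∧ α₁ < 0 ∧
      ∀ α : ℝ, α ≤ α₁ → IsHurwitz (F + α • H) := by
  have : Nonempty (Fin n) := ⟨⟨0, hn⟩⟩
  let G := F + 1
  obtain ⟨b, φ, hφ⟩ := exists_functional_pow_apply_eq_ite (toLin' G)
  have hint : IsIntegral ℝ (toLin' G) := Algebra.IsIntegral.isIntegral _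
  have hmpos := minpoly.natDegree_pos hint
  set m := minpoly ℝ (toLin' G) with hm
  obtain ⟨c, rfl⟩ := (dotProductEquiv ℝ (Fin n)).surjective φ
  have hc : ∀ i < m.natDegree, c ⬝ᵥ (G ^ i *ᵥ b) = if i = m.natDegree - 1 then 1 else 0 := by
    simpa only [← toLin'_pow, toLin'_apply, dotProductEquiv_apply_apply] using hφ
  let b' := (G ^ (m.natDegree - 1)) *ᵥ b
  have hcb' : c ⬝ᵥ b' = 1 := by
    simpa using hc (m.natDegree - 1) (by omega)
  let P := m.map (algebraMap ℝ ℂ)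
  have hPdeg : P.natDegree = m.natDegree := Polynomial.natDegree_map _
  have hP : P.Monic := (minpoly.monic hint).map _
  obtain ⟨k₀, hk₀, hroot⟩ := exists_forall_eval_add_mul_pow_ne_zero hP (hPdeg ▸ hmpos)
  refine ⟨vecMulVec b' c, -k₀, rank_vecMulVec_eq_one ?_ ?_, by linarith, fun α hα μ hμ ↦ ?_⟩
  · intro h
    simp [h] at hcb'
  · intro h
    simp [h] at hcb'
  by_contra! hre
  obtain ⟨v, hv, hv0⟩ := hμ.exists_hasEigenvector
  have hv' := Module.End.mem_eigenspace_iff.mp hv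
  rw [toLin'_apply, map_ofReal_add_smul_vecMulVec_mulVec] at hv'
  let g : Module.End ℂ (Fin n → ℂ) := toLin' (G.map Complex.ofReal)
  have hgpow : ∀ i, (g ^ i) (Complex.ofReal ∘ b) = Complex.ofReal ∘ (G ^ i *ᵥ b) := by
    intro i
    rw [← toLin'_pow, toLin'_apply]
    ext j
    have := RingHom.map_mulVec Complex.ofRealHom (G ^ i) b j
    rw [Matrix.map_pow] at this
    exact this.symm
  have hgF : ∀ w, g w = F.map Complex.ofReal *ᵥ w + w := by
    intro w
    have : G.map Complex.ofReal = F.map Complex.ofReal + 1 := by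
      rw [Matrix.map_add _ Complex.ofReal_add, Matrix.map_one _ Complex.ofReal_zero
        Complex.ofReal_one]
    rw [toLin'_apply, this, add_mulVec, one_mulVec]
  have hPg : Polynomial.aeval g P = 0 := by
    have h : Polynomial.aeval ((Algebra.ofId ℝ ℂ).mapMatrix G) m = 0 := by
      rw [Polynomial.aeval_algHom_apply, hm, minpoly_toLin', minpoly.aeval, map_zero]
    rw [← Polynomial.aeval_map_algebraMap ℂ] at h
    have h' := Polynomial.aeval_algHom_apply (toLinAlgEquiv' (R := ℂ) (n := Fin n))
      ((Algebra.ofId ℝ ℂ).mapMatrix G) P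
    rw [h, map_zero] at h'
    exact h'
  refine hroot (-α) (by linarith) (μ + 1) (by simpa using hre)
    (eval_add_mul_pow_eq_zero_of_eigenvector g (Complex.ofReal ∘ b)
      (dotProductBilin ℂ ℂ (Complex.ofReal ∘ c)) hP (hPdeg ▸ hmpos) hPg ?_ hv0 ?_ ?_)
  · intro i hi
    rw [hPdeg] at hi ⊢
    rw [hgpow]
    have := RingHom.map_dotProduct Complex.ofRealHom c (G ^ i *ᵥ b)
    refine this.symm.trans ?_
    rw [hc i hi]
    split_ifs <;> simp
  · rw [hPdeg, hgpow, hgF, add_smul, one_smul, ← hv', Complex.ofReal_neg, neg_mul, neg_smul,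
      sub_neg_eq_add]
    exact add_right_comm _ _ _
  · have hspace : g.eigenspace (μ + 1) =
        Module.End.eigenspace (Matrix.toLin' (F.map (Complex.ofReal : ℝ → ℂ))) μ := by
      ext w
      simp [hgF, add_smul]
    intro h
    rw [hspace]
    refine hF μ ?_ hre
    rwa [Module.End.hasEigenvalue_iff, hspace, ← Module.End.hasEigenvalue_iff] at h

/-- There exist a rank-one real matrix `H` and `α₁ < 0` such that `F + α H`
is Hurwitz for every `α ≤ α₁` iff every complex eigenvalue of `F` with nonnegative real
part has geometric multiplicity one. -/
theorem exists_rank_one_unbounded_stable_region_iff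
    (n : ℕ) (hn : 1 ≤ n) (F : Matrix (Fin n) (Fin n) ℝ) :
    (∃ (H : Matrix (Fin n) (Fin n) ℝ) (α₁ : ℝ), H.rank = 1 ∧ α₁ < 0 ∧
        ∀ α : ℝ, α ≤ α₁ → IsHurwitz (F + α • H)) ↔
    (∀ μ : ℂ,
        Module.End.HasEigenvalue (Matrix.toLin' (F.map (Complex.ofReal : ℝ → ℂ))) μ →
        0 ≤ μ.re → geomMult F μ = 1) :=
  ⟨fun ⟨_, α₁, hH, _, hα⟩ _ hμ hre ↦
    geomMult_eq_one_of_isHurwitz_add_smul hH (hα α₁ le_rfl) hμ hre,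
    exists_rank_one_forall_isHurwitz hn F⟩
end

section
/- Let n ≥ 1 and let F be an n×n real matrix such that every complex eigenvalue λ of F with Re(λ) ≥ 0 has geometric multiplicity 1. Then there exist column vectors b, k ∈ ℝⁿ such that for every real α ≤ −1 the matrix F + α·b·kᵀ is Hurwitz. -/
open Matrix

open PowerSeries in
/-- If `d` annihilates `u` in degree `M + 1`, and `u` is generated by
`u (l + 1) = ν * u l - α * t l * u 0` where `t` is `C` times the inverse of `d`, then `ν` is a root
of the reversal of `d` in degree `M + 1`, perturbed by `-α * C * ν ^ M`. -/
lemma perturbed_charpoly_root (M : ℕ) (d t u : PowerSeries ℂ) (ν α C : ℂ)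
    (hdt : d * t = PowerSeries.C C)
    (hu : ∀ l, coeff (l + 1) u = ν * coeff l u - α * coeff l t * coeff 0 u)
    (hrel : coeff (M + 1) (d * u) = 0) (hu0 : coeff 0 u ≠ 0) :
    ∑ p ∈ Finset.HasAntidiagonal.antidiagonal (M + 1), coeff p.1 d * ν ^ p.2 = α * C * ν ^ M := by
  set g : PowerSeries ℂ := PowerSeries.mk fun i => ν ^ i with hg
  have hgeom : (1 - PowerSeries.C ν * X) * g = 1 := by
    ext l
    cases l with
    | zero => simp [sub_mul, mul_assoc, hg]
    | succ l => simp [sub_mul, mul_assoc, hg, coeff_succ_X_mul, pow_succ', PowerSeries.coeff_one]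
  have hlin : (1 - PowerSeries.C ν * X) * u =
      PowerSeries.C (coeff 0 u) * (1 - PowerSeries.C α * X * t) := by
    ext l
    cases l with
    | zero => simp [sub_mul, mul_sub, mul_assoc]
    | succ l =>
      have := hu l
      simp only [sub_mul, mul_sub, mul_assoc, one_mul, map_sub, coeff_C_mul, coeff_succ_X_mul,
        mul_one, PowerSeries.coeff_C, this]
      simp
      ring
  have hdu : d * u = PowerSeries.C (coeff 0 u) *
      (d * g - PowerSeries.C (α * C) * (X * g)) := by
    rw [map_mul]
    linear_combination (-d * u) * hgeom + d * g * hlin -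
      PowerSeries.C (coeff 0 u) * PowerSeries.C α * X * g * hdt
  rw [hdu, coeff_C_mul, map_sub, coeff_C_mul, coeff_succ_X_mul] at hrel
  have h := (mul_eq_zero.mp hrel).resolve_left hu0
  rw [PowerSeries.coeff_mul] at h
  simpa [hg] using sub_eq_zero.mp h

/-- A large multiple of `z ^ M` dominates a monic polynomial of degree `M + 1` on `1 ≤ Re z`. -/
lemma monic_sum_ne_high_gain (M : ℕ) (c : ℕ → ℝ) (C α : ℝ) (ν : ℂ)
    (hC : ∑ i ∈ Finset.range (M + 1), |c i| ≤ C) (hα : α ≤ -1) (hν : 1 ≤ ν.re) :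
    ν ^ (M + 1) + ∑ i ∈ Finset.range (M + 1), (c i : ℂ) * ν ^ i ≠ α * C * ν ^ M := by
  intro h
  have hC0 : 0 ≤ C := (Finset.sum_nonneg fun _ _ => abs_nonneg _).trans hC
  have hν1 : 1 ≤ ‖ν‖ := hν.trans (Complex.re_le_norm ν)
  have h1 : (ν - α * C) * ν ^ M = -∑ i ∈ Finset.range (M + 1), (c i : ℂ) * ν ^ i := by
    rw [pow_succ'] at h
    linear_combination h
  have h2 : ‖∑ i ∈ Finset.range (M + 1), (c i : ℂ) * ν ^ i‖ ≤ C * ‖ν‖ ^ M := by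
    calc _ ≤ ∑ i ∈ Finset.range (M + 1), ‖(c i : ℂ) * ν ^ i‖ := norm_sum_le _ _
      _ ≤ ∑ i ∈ Finset.range (M + 1), |c i| * ‖ν‖ ^ M := by
        refine Finset.sum_le_sum fun i hi => ?_
        rw [norm_mul, norm_pow, Complex.norm_real, Real.norm_eq_abs]
        have : i ≤ M := Nat.lt_succ_iff.mp (Finset.mem_range.mp hi)
        gcongr
      _ ≤ C * ‖ν‖ ^ M := by rw [← Finset.sum_mul]; gcongr
  have h3 : 1 + C ≤ ‖ν - α * C‖ := by
    refine le_trans ?_ (Complex.re_le_norm _)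
    have : (ν - α * C).re = ν.re - α * C := by simp
    rw [this]
    nlinarith
  have h4 := congrArg norm h1
  rw [norm_mul, norm_pow, norm_neg] at h4
  have h5 : 0 < ‖ν‖ ^ M := by positivity
  nlinarith

/-- A linear system with linearly independent rows is solvable. -/
lemma exists_dotProduct_eq {K : Type*} [Field K] {ι : Type*} {n : ℕ} {v : ι → Fin n → K}
    (hv : LinearIndependent K v) (t : ι → K) : ∃ b : Fin n → K, ∀ i, v i ⬝ᵥ b = t i := by
  obtain ⟨f, hf⟩ : ∃ f : (Fin n → K) →ₗ[K] K, ∀ i, f (v i) = t i := by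
    obtain ⟨f, hf⟩ := ((Module.Basis.span hv).constr K t).exists_extend
    refine ⟨f, fun i => ?_⟩
    have h := LinearMap.congr_fun hf (Module.Basis.span hv i)
    rw [Module.Basis.constr_basis] at h
    simpa [Module.Basis.span_apply] using h
  refine ⟨fun j => f (Pi.single j 1), fun i => ?_⟩
  rw [← hf i, LinearMap.pi_apply_eq_sum_univ f (v i)]
  simp only [dotProduct, smul_eq_mul]
  refine Finset.sum_congr rfl fun j _ => ?_
  congr 2
  ext l
  simp [Pi.single_apply, eq_comm]

/-- The first linear relation among the Krylov row vectors `k, kY, kY², …` of `k ≠ 0`. -/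
lemma exists_krylov_relation {K : Type*} [Field K] {n : ℕ} (Y : Matrix (Fin n) (Fin n) K)
    {k : Fin n → K} (hk : k ≠ 0) :
    ∃ (M : ℕ) (c : ℕ → K), LinearIndependent K (fun i : Fin (M + 1) => k ᵥ* Y ^ (i : ℕ)) ∧
      k ᵥ* Y ^ (M + 1) + ∑ i ∈ Finset.range (M + 1), c i • (k ᵥ* Y ^ i) = 0 := by
  classical
  have hex : ∃ m : ℕ, ¬ LinearIndependent K (fun i : Fin (m + 1) => k ᵥ* Y ^ (i : ℕ)) := by
    refine ⟨n, fun h => ?_⟩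
    have := h.fintype_card_le_finrank
    simp at this
  obtain ⟨M, hM⟩ : ∃ M, Nat.find hex = M + 1 := by
    refine Nat.exists_eq_succ_of_ne_zero fun h0 => ?_
    have := Nat.find_spec hex
    rw [h0] at this
    exact this (by simpa [linearIndependent_unique_iff] using hk)
  have hind : LinearIndependent K (fun i : Fin (M + 1) => k ᵥ* Y ^ (i : ℕ)) :=
    not_not.mp (Nat.find_min hex (m := M) (by omega))
  have hdep := Nat.find_spec hex
  rw [hM, linearIndependent_finSucc'] at hdep
  have hmem : k ᵥ* Y ^ (M + 1) ∈
      Submodule.span K (Set.range fun i : Fin (M + 1) => k ᵥ* Y ^ (i : ℕ)) := by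
    by_contra hcon
    exact hdep ⟨hind, hcon⟩
  obtain ⟨a, ha⟩ := (Submodule.mem_span_range_iff_exists_fun K).mp hmem
  refine ⟨M, fun i => if h : i < M + 1 then -a ⟨i, h⟩ else 0, hind, ?_⟩
  rw [Finset.sum_range, ← ha, ← Finset.sum_add_distrib]
  exact Finset.sum_eq_zero fun i _ => by simp [Nat.lt_succ_iff.mp i.isLt]

/-- The real-linear functional `v ↦ v ⬝ᵥ x` on real vectors, for a complex vector `x`. -/
noncomputable def realDotProduct {n : ℕ} (x : Fin n → ℂ) : (Fin n → ℝ) →ₗ[ℝ] ℂ where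
  toFun v := (Complex.ofReal ∘ v) ⬝ᵥ x
  map_add' a b := by simp [dotProduct, add_mul, Finset.sum_add_distrib]
  map_smul' r a := by simp [dotProduct, mul_assoc, Finset.mul_sum]

/-- If all unstable eigenvalues are geometrically simple, some real row vector is nonzero on
every unstable eigenvector. -/
lemma exists_dotProduct_eigenvector_ne_zero {n : ℕ} (F : Matrix (Fin n) (Fin n) ℝ)
    (hF : ∀ μ : ℂ,
        Module.End.HasEigenvalue (Matrix.toLin' (F.map (Complex.ofReal : ℝ → ℂ))) μ →
        0 ≤ μ.re → geomMult F μ = 1) :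
    ∃ k : Fin n → ℝ, ∀ (μ : ℂ) (x : Fin n → ℂ), 0 ≤ μ.re → x ≠ 0 →
      F.map (Complex.ofReal : ℝ → ℂ) *ᵥ x = μ • x → (Complex.ofReal ∘ k) ⬝ᵥ x ≠ 0 := by
  classical
  set T := Matrix.toLin' (F.map (Complex.ofReal : ℝ → ℂ)) with hT
  have hgen : ∀ μ : ℂ, ∃ y : Fin n → ℂ, (y ≠ 0 ∧ ∀ x, T x = μ • x → ∃ a : ℂ, a • y = x) ∨
      ¬ Module.End.HasEigenvalue T μ ∨ μ.re < 0 := by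
    intro μ
    by_cases h : Module.End.HasEigenvalue T μ ∧ 0 ≤ μ.re
    · obtain ⟨⟨y, hyT⟩, hy0, hy⟩ := finrank_eq_one_iff'.mp (hF μ h.1 h.2)
      refine ⟨y, Or.inl ⟨by simpa using hy0, fun x hx => ?_⟩⟩
      obtain ⟨a, ha⟩ := hy ⟨x, Module.End.mem_eigenspace_iff.mpr hx⟩
      exact ⟨a, congrArg Subtype.val ha⟩
    · refine ⟨0, Or.inr ?_⟩
      by_contra! hcon
      exact h hcon
  choose y hy using hgen
  let S : Finset ℂ := (Module.End.finite_hasEigenvalue T).toFinset.filter fun μ => 0 ≤ μ.re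
  let f : ℂ → (Fin n → ℝ) →ₗ[ℝ] ℂ := fun μ => realDotProduct (y μ)
  have htop : ∀ μ ∈ S, LinearMap.ker (f μ) ≠ ⊤ := by
    intro μ hμ htop
    simp only [S, Finset.mem_filter, Set.Finite.mem_toFinset, Set.mem_ofPred_eq] at hμ
    have hy0 : y μ ≠ 0 := by
      rcases hy μ with h | h | h
      · exact h.1
      · exact absurd hμ.1 h
      · exact absurd hμ.2 (not_le.mpr h)
    refine hy0 (funext fun j => ?_)
    have h : f μ (Pi.single j 1) = 0 := by
      rw [← LinearMap.mem_ker, htop]; trivial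
    simpa [f, realDotProduct, dotProduct, Pi.single_apply, apply_ite Complex.ofReal] using h
  obtain ⟨k, hk⟩ : ∃ k, ∀ μ ∈ S, f μ k ≠ 0 := by
    have h := Subspace.biUnion_ne_univ_of_top_notMem (k := ℝ) (E := Fin n → ℝ)
      (s := S.image fun μ => LinearMap.ker (f μ)) (by simpa using fun μ hμ => htop μ hμ)
    obtain ⟨k, hk⟩ := (Set.ne_univ_iff_exists_notMem _).mp h
    exact ⟨k, fun μ hμ hcon => hk (Set.mem_biUnion (Finset.mem_coe.mpr
      (Finset.mem_image_of_mem _ hμ)) (LinearMap.mem_ker.mpr hcon))⟩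
  refine ⟨k, fun μ x hμ hx0 hx => ?_⟩
  have hx' : T x = μ • x := by rw [hT, Matrix.toLin'_apply, hx]
  have hev : Module.End.HasEigenvalue T μ :=
    Module.End.hasEigenvalue_of_hasEigenvector ⟨Module.End.mem_eigenspace_iff.mpr hx', hx0⟩
  have hμS : μ ∈ S := by simp [S, hμ, hev]
  rcases hy μ with h | h | h
  · obtain ⟨a, rfl⟩ := h.2 x hx'
    rw [dotProduct_smul]
    exact smul_ne_zero (fun ha => hx0 (by simp [ha])) (hk μ hμS)
  · exact absurd hev h
  · exact absurd hμ (not_le.mpr h)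

/-- If every complex eigenvalue of `F` with nonnegative real part has
geometric multiplicity one, then there are vectors `b, k` such that `F + α b kᵀ`
is Hurwitz for every `α ≤ -1`. -/
theorem exists_rank_one_feedback_stable
    (n : ℕ) (hn : 1 ≤ n) (F : Matrix (Fin n) (Fin n) ℝ)
    (hF : ∀ μ : ℂ,
        Module.End.HasEigenvalue (Matrix.toLin' (F.map (Complex.ofReal : ℝ → ℂ))) μ →
        0 ≤ μ.re → geomMult F μ = 1) :
    ∃ b k : Fin n → ℝ, ∀ α : ℝ, α ≤ -1 →
      IsHurwitz (F + α • Matrix.vecMulVec b k) := by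
  obtain ⟨k, hk⟩ := exists_dotProduct_eigenvector_ne_zero F hF
  have key : ∀ b : Fin n → ℝ, (∀ (α : ℝ) (μ : ℂ) (x : Fin n → ℂ), α ≤ -1 → 0 ≤ μ.re →
      (Complex.ofReal ∘ k) ⬝ᵥ x ≠ 0 → F.map (Complex.ofReal : ℝ → ℂ) *ᵥ x =
        μ • x - ((α : ℂ) * ((Complex.ofReal ∘ k) ⬝ᵥ x)) • (Complex.ofReal ∘ b) → False) →
      ∀ α : ℝ, α ≤ -1 → IsHurwitz (F + α • Matrix.vecMulVec b k) := by
    intro b hb α hα μ hμ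
    by_contra! hre
    obtain ⟨x, hx, hx0⟩ := hμ.exists_hasEigenvector
    rw [Module.End.mem_eigenspace_iff, Matrix.toLin'_apply] at hx
    have hmap : (F + α • Matrix.vecMulVec b k).map (Complex.ofReal : ℝ → ℂ) *ᵥ x =
        F.map (Complex.ofReal : ℝ → ℂ) *ᵥ x +
          ((α : ℂ) * ((Complex.ofReal ∘ k) ⬝ᵥ x)) • (Complex.ofReal ∘ b) := by
      ext i
      simp only [mulVec, dotProduct, Matrix.map_apply, Matrix.add_apply, Matrix.smul_apply,
        vecMulVec_apply, Pi.add_apply, Pi.smul_apply, smul_eq_mul, Function.comp_apply,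
        Complex.ofReal_add, Complex.ofReal_mul, add_mul, Finset.sum_add_distrib, Finset.mul_sum,
        Finset.sum_mul]
      congr 1
      exact Finset.sum_congr rfl fun j _ => by ring
    rw [hmap] at hx
    have hFx := eq_sub_of_add_eq hx
    by_cases hkx : (Complex.ofReal ∘ k) ⬝ᵥ x = 0
    · exact hk μ x hre hx0 (by simpa [hkx] using hFx) hkx
    · exact hb α μ x hα hre hkx hFx
  by_cases hk0 : k = 0
  · refine ⟨0, k, key 0 fun α μ x _ _ hkx _ => hkx ?_⟩
    simp [hk0, dotProduct]
  obtain ⟨M, c, hind, hrel⟩ := exists_krylov_relation (F + 1) hk0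
  let r : ℕ → Fin n → ℝ := fun l => k ᵥ* (F + 1) ^ l
  let C : ℝ := ∑ i ∈ Finset.range (M + 1), |c i|
  let d : PowerSeries ℝ := PowerSeries.mk fun i => if i = 0 then 1 else c (M + 1 - i)
  let t : PowerSeries ℝ := PowerSeries.C C * d⁻¹
  have hdt : d * t = PowerSeries.C C := by
    have hd : d * d⁻¹ = 1 := PowerSeries.mul_inv_cancel _ (by simp [d])
    calc d * t = PowerSeries.C C * (d * d⁻¹) := by ring
      _ = _ := by rw [hd, mul_one]
  have hdsum : ∀ v : ℕ → ℂ, ∑ p ∈ Finset.HasAntidiagonal.antidiagonal (M + 1),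
      PowerSeries.coeff p.1 (d.map Complex.ofRealHom) * v p.2 =
      v (M + 1) + ∑ i ∈ Finset.range (M + 1), (c i : ℂ) * v i := by
    intro v
    rw [Finset.Nat.sum_antidiagonal_eq_sum_range_succ_mk, ← Finset.sum_range_reflect,
      Finset.sum_range_succ, add_comm]
    congr 1
    · simp [d]
    · refine Finset.sum_congr rfl fun i hi => ?_
      have hi := Finset.mem_range.mp hi
      have h1 : M + 1 + 1 - 1 - i ≠ 0 := by omega
      have h2 : M + 1 - (M + 1 + 1 - 1 - i) = i := by omega
      simp only [d, PowerSeries.coeff_map, PowerSeries.coeff_mk, if_neg h1, h2]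
      simp
  obtain ⟨b, hb⟩ := exists_dotProduct_eq hind fun i => PowerSeries.coeff (i : ℕ) t
  refine ⟨b, k, key b fun α μ x hα hμ hkx hx => ?_⟩
  have hr1 : ∀ l, r (l + 1) = r l ᵥ* (F + 1) := fun l => by
    simp [r, pow_succ, ← Matrix.vecMul_vecMul]
  have hr0 : r 0 = k := by simp [r]
  let φ := realDotProduct x
  have hφ : ∀ v, φ v = (Complex.ofReal ∘ v) ⬝ᵥ x := fun v => rfl
  have hstep : ∀ v, φ (v ᵥ* (F + 1)) = (μ + 1) * φ v - α * (v ⬝ᵥ b : ℝ) * φ k := by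
    intro v
    have h1 : Complex.ofReal ∘ (v ᵥ* F) =
        (Complex.ofReal ∘ v) ᵥ* F.map (Complex.ofReal : ℝ → ℂ) := by
      ext i
      simp [vecMul, dotProduct]
    have h2 : (Complex.ofReal ∘ v) ⬝ᵥ (Complex.ofReal ∘ b) = ((v ⬝ᵥ b : ℝ) : ℂ) := by
      simp [dotProduct]
    rw [Matrix.vecMul_add, Matrix.vecMul_one, map_add, hφ, hφ, hφ, h1, ← Matrix.dotProduct_mulVec,
      hx, dotProduct_sub, dotProduct_smul, dotProduct_smul, h2, smul_eq_mul, smul_eq_mul]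
    ring
  have hrelφ : φ (r (M + 1)) + ∑ i ∈ Finset.range (M + 1), (c i : ℂ) * φ (r i) = 0 := by
    have h := congrArg φ hrel
    simpa only [map_add, map_sum, map_smul, map_zero, Complex.real_smul] using h
  let w : ℕ → ℂ := fun l => Nat.rec (φ k)
    (fun l z => (μ + 1) * z - α * (PowerSeries.coeff l t : ℝ) * φ k) l
  have hw : ∀ l, w (l + 1) = (μ + 1) * w l - α * (PowerSeries.coeff l t : ℝ) * φ k := fun _ => rfl
  have hwr : ∀ l ≤ M + 1, w l = φ (r l) := by
    intro l
    induction l with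
    | zero => exact fun _ => congrArg φ hr0.symm
    | succ l ih =>
      intro hl
      rw [hw, ih (by omega), hr1, hstep, ← hb ⟨l, by omega⟩]
  have hroot := perturbed_charpoly_root M (d.map Complex.ofRealHom) (t.map Complex.ofRealHom)
    (PowerSeries.mk w) (μ + 1) α C (by rw [← map_mul, hdt, PowerSeries.map_C]; rfl)
    (fun l => by
      simp only [PowerSeries.coeff_mk, PowerSeries.coeff_map, hw]
      rfl)
    (by
      simp only [PowerSeries.coeff_mul, PowerSeries.coeff_mk]
      rw [hdsum w, hwr _ le_rfl, ← hrelφ]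
      congr 1
      refine Finset.sum_congr rfl fun i hi => ?_
      rw [hwr i (Finset.mem_range.mp hi).le])
    (by rw [PowerSeries.coeff_mk]; exact hkx)
  rw [hdsum fun i => (μ + 1) ^ i] at hroot
  exact monic_sum_ne_high_gain M c C α (μ + 1) le_rfl hα (by simpa using hμ) hroot
end

section
/- Let n ≥ 1, let F be an n×n real matrix, and let b ∈ ℝⁿ be a column vector. If there exists a row vector k ∈ ℝⁿ such that F − b·k is Hurwitz, then there exists a symmetric positive definite n×n real matrix P such that F·P + P·Fᵀ − 2·b·bᵀ is negative definite. -/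
open Matrix

open scoped Matrix.Norms.L2Operator

/-- An element of a complex Banach algebra whose spectrum lies in the open unit disc has a power
of norm less than one. -/
theorem exists_norm_pow_lt_one_of_spectrum {A : Type*} [NormedRing A] [NormedAlgebra ℂ A]
    [CompleteSpace A] [Nontrivial A] (a : A) (ha : ∀ z ∈ spectrum ℂ a, ‖z‖ < 1) :
    ∃ m : ℕ, ‖a ^ m‖ < 1 := by
  have hr : spectralRadius ℂ a < (1 : NNReal) :=
    spectrum.spectralRadius_lt_of_forall_lt a fun z hz => by exact_mod_cast ha z hz
  have ht := spectrum.pow_nnnorm_pow_one_div_tendsto_nhds_spectralRadius a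
  obtain ⟨m, hm, hm0⟩ := ((ht.eventually_lt_const hr).and (Filter.eventually_gt_atTop 0)).exists
  refine ⟨m, ?_⟩
  by_contra! hle
  refine absurd hm (not_lt.2 ?_)
  have h1 : (1 : ENNReal) ≤ (‖a ^ m‖₊ : ENNReal) := by exact_mod_cast hle
  simpa using ENNReal.one_le_rpow h1 (z := 1 / (m : ℝ)) (by positivity)

/-- If the complexification of a real matrix `M` has operator norm less than one, then
`1 - M Mᵀ` is positive definite. -/
theorem posDef_one_sub_mul_transpose {ι : Type*} [Fintype ι] [DecidableEq ι]
    (M : Matrix ι ι ℝ) (hM : ‖M.map (Complex.ofReal : ℝ → ℂ)‖ < 1) :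
    (1 - M * Mᵀ).PosDef := by
  refine PosDef.of_dotProduct_mulVec_pos ?_ fun x hx => ?_
  · simp [IsHermitian]
  have hnorm (y : ι → ℝ) :
      ‖(WithLp.toLp 2 fun i => (y i : ℂ) : EuclideanSpace ℂ ι)‖ ^ 2 = y ⬝ᵥ y := by
    rw [EuclideanSpace.norm_sq_eq]
    simp [dotProduct, sq]
  have hmap : ((M.map (Complex.ofReal : ℝ → ℂ))ᴴ *ᵥ fun i => (x i : ℂ)) =
      fun i => ((Mᵀ *ᵥ x) i : ℂ) := by
    ext i
    simp [mulVec, dotProduct]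
  have hle := l2_opNorm_mulVec (M.map (Complex.ofReal : ℝ → ℂ))ᴴ
    (WithLp.toLp 2 fun i => (x i : ℂ) : EuclideanSpace ℂ ι)
  rw [l2_opNorm_conjTranspose] at hle
  change ‖(WithLp.toLp 2 ((M.map (Complex.ofReal : ℝ → ℂ))ᴴ *ᵥ fun i => (x i : ℂ)) :
    EuclideanSpace ℂ ι)‖ ≤ _ at hle
  rw [hmap] at hle
  have hx0 : 0 < x ⬝ᵥ x := by simpa using (dotProduct_star_self_pos_iff (v := x)).2 hx
  have hpos : 0 < ‖(WithLp.toLp 2 fun i => (x i : ℂ) : EuclideanSpace ℂ ι)‖ := by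
    rw [← hnorm] at hx0
    exact lt_of_pow_lt_pow_left₀ 2 (norm_nonneg _) (by simpa using hx0)
  have hlt := hle.trans_lt (mul_lt_of_lt_one_left hpos hM)
  have hsq := pow_lt_pow_left₀ hlt (norm_nonneg _) two_ne_zero
  rw [hnorm, hnorm] at hsq
  have hquad : x ⬝ᵥ ((M * Mᵀ) *ᵥ x) = (Mᵀ *ᵥ x) ⬝ᵥ (Mᵀ *ᵥ x) := by
    rw [← mulVec_mulVec, dotProduct_mulVec, mulVec_transpose]
  simp only [star_trivial, sub_mulVec, one_mulVec, dotProduct_sub, hquad]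
  linarith

/-- Discrete Lyapunov (Stein) inequality for a matrix some power of which is a contraction. -/
theorem exists_posDef_sub_mul_mul_transpose {ι : Type*} [Fintype ι] [DecidableEq ι]
    (B : Matrix ι ι ℝ) (m : ℕ) (hm : (1 - B ^ m * (B ^ m)ᵀ).PosDef) :
    ∃ P : Matrix ι ι ℝ, P.PosDef ∧ (P - B * P * Bᵀ).PosDef := by
  let P : Matrix ι ι ℝ := ∑ k ∈ Finset.range m, B ^ k * (B ^ k)ᵀ
  have hP : P.PosSemidef := posSemidef_sum _ fun k _ => by
    simpa using posSemidef_self_mul_conjTranspose (B ^ k)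
  have hstein : P - B * P * Bᵀ = 1 - B ^ m * (B ^ m)ᵀ := by
    have hshift : B * P * Bᵀ = ∑ k ∈ Finset.range m, B ^ (k + 1) * (B ^ (k + 1))ᵀ := by
      simp only [P, Finset.mul_sum, Finset.sum_mul]
      refine Finset.sum_congr rfl fun k _ => ?_
      rw [pow_succ' B k, transpose_mul]
      simp only [Matrix.mul_assoc]
    rw [hshift, ← Finset.sum_sub_distrib,
      Finset.sum_range_sub' (fun k => B ^ k * (B ^ k)ᵀ) m]
    simp
  have hD : (P - B * P * Bᵀ).PosDef := hstein ▸ hm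
  refine ⟨P, ?_, hD⟩
  have hsum := hD.add_posSemidef (by simpa using hP.mul_mul_conjTranspose_same B)
  rwa [sub_add_cancel] at hsum

/-- The inverse Cayley transform `z ↦ (z - 1) / (z + 1)` maps only points of the open unit disc
into the open left half plane. -/
theorem norm_lt_one_of_div_re_neg {z : ℂ} (hz : ((z - 1) / (z + 1)).re < 0) : ‖z‖ < 1 := by
  have hne : z + 1 ≠ 0 := fun h => by simp [h] at hz
  have hpos : 0 < Complex.normSq (z + 1) := Complex.normSq_pos.2 hne
  rw [Complex.div_re, ← add_div, div_neg_iff] at hz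
  have hneg := (hz.resolve_left fun h => hpos.not_gt h.2).1
  simp only [Complex.sub_re, Complex.add_re, Complex.one_re, Complex.sub_im, Complex.add_im,
    Complex.one_im] at hneg
  have hsq : ‖z‖ ^ 2 < 1 := by
    rw [Complex.sq_norm, Complex.normSq_apply]
    linarith
  exact (sq_lt_one_iff₀ (norm_nonneg z)).1 hsq

/-- A Hurwitz matrix does not have the eigenvalue `1`. -/
theorem IsHurwitz.isUnit_one_sub {n : ℕ} {A : Matrix (Fin n) (Fin n) ℝ} (hA : IsHurwitz A) :
    IsUnit (1 - A) := by
  rw [isUnit_iff_isUnit_det, isUnit_iff_ne_zero]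
  intro hdet
  have hdet' : ((1 - A).map (Complex.ofReal : ℝ → ℂ)).det = 0 := by
    have := Complex.ofRealHom.map_det (1 - A)
    rw [hdet, map_zero] at this
    exact this.symm
  obtain ⟨v, hv, hv0⟩ := exists_mulVec_eq_zero_iff.2 hdet'
  have hsub : (1 - A).map (Complex.ofReal : ℝ → ℂ) = 1 - A.map (Complex.ofReal : ℝ → ℂ) :=
    (map_sub Complex.ofRealHom.mapMatrix 1 A).trans (by rw [map_one]; rfl)
  rw [hsub, sub_mulVec, one_mulVec, sub_eq_zero] at hv0
  have := hA 1 (Module.End.hasEigenvalue_of_hasEigenvector (x := v)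
    ⟨Module.End.mem_eigenspace_iff.2 (by simp [← hv0]), hv⟩)
  norm_num at this

/-- The Cayley transform of a Hurwitz matrix has its spectrum in the open unit disc. -/
theorem IsHurwitz.norm_lt_one_of_mem_spectrum_cayley {n : ℕ} {A B : Matrix (Fin n) (Fin n) ℝ}
    (hA : IsHurwitz A) (hB : (1 - A) * B = 1 + A) {z : ℂ}
    (hz : z ∈ spectrum ℂ (B.map (Complex.ofReal : ℝ → ℂ))) : ‖z‖ < 1 := by
  rw [← spectrum_toLin', ← Module.End.hasEigenvalue_iff_mem_spectrum] at hz
  obtain ⟨v, hv⟩ := hz.exists_hasEigenvector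
  have hBv : B.map (Complex.ofReal : ℝ → ℂ) *ᵥ v = z • v := by simpa using hv.apply_eq_smul
  have hB' : (1 - A.map (Complex.ofReal : ℝ → ℂ)) * B.map (Complex.ofReal : ℝ → ℂ) =
      1 + A.map (Complex.ofReal : ℝ → ℂ) := by
    have := congrArg Complex.ofRealHom.mapMatrix hB
    rwa [map_mul, map_sub, map_add, map_one] at this
  have hv1 := congrArg (· *ᵥ v) hB'
  simp only [← mulVec_mulVec, hBv, mulVec_smul, sub_mulVec, add_mulVec, one_mulVec] at hv1
  set w := A.map (Complex.ofReal : ℝ → ℂ) *ᵥ v with hw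
  have hAv : (z + 1) • w = (z - 1) • v := by
    linear_combination (norm := module) -hv1
  have hne : z + 1 ≠ 0 := by
    intro h
    rw [h, zero_smul, eq_comm, smul_eq_zero_iff_left hv.2] at hAv
    have h2 : (2 : ℂ) = 0 := by linear_combination h - hAv
    norm_num at h2
  refine norm_lt_one_of_div_re_neg (hA _ (Module.End.hasEigenvalue_of_hasEigenvector (x := v)
    ⟨Module.End.mem_eigenspace_iff.2 ?_, hv.2⟩))
  rw [toLin'_apply, ← hw, div_eq_inv_mul, mul_smul, ← hAv, smul_smul, inv_mul_cancel₀ hne,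
    one_smul]

/-- Lyapunov's theorem: a Hurwitz matrix `A` admits a positive definite `P` with
`A P + P Aᵀ` negative definite. -/
theorem IsHurwitz.exists_posDef_lyapunov {n : ℕ} [NeZero n] {A : Matrix (Fin n) (Fin n) ℝ}
    (hA : IsHurwitz A) :
    ∃ P : Matrix (Fin n) (Fin n) ℝ, P.PosDef ∧ (-(A * P + P * Aᵀ)).PosDef := by
  have hu := hA.isUnit_one_sub
  have hB : (1 - A) * ((1 - A)⁻¹ * (1 + A)) = 1 + A :=
    mul_nonsing_inv_cancel_left _ _ ((isUnit_iff_isUnit_det _).1 hu)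
  set B := (1 - A)⁻¹ * (1 + A)
  obtain ⟨m, hm⟩ := exists_norm_pow_lt_one_of_spectrum (B.map (Complex.ofReal : ℝ → ℂ))
    fun z hz => hA.norm_lt_one_of_mem_spectrum_cayley hB hz
  have hpow : B.map (Complex.ofReal : ℝ → ℂ) ^ m = (B ^ m).map (Complex.ofReal : ℝ → ℂ) :=
    (map_pow Complex.ofRealHom.mapMatrix B m).symm
  rw [hpow] at hm
  obtain ⟨P, hP, hD⟩ :=
    exists_posDef_sub_mul_mul_transpose B m (posDef_one_sub_mul_transpose _ hm)
  refine ⟨P, hP, ?_⟩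
  have hconj := hD.mul_mul_conjTranspose_same (vecMul_injective_of_isUnit hu)
  have hB' : Bᵀ * (1 - A)ᵀ = (1 + A)ᵀ := by rw [← transpose_mul, hB]
  have hid : (1 - A) * (P - B * P * Bᵀ) * (1 - A)ᴴ = (2 : ℝ) • -(A * P + P * Aᵀ) := by
    calc (1 - A) * (P - B * P * Bᵀ) * (1 - A)ᴴ
        = (1 - A) * P * (1 - A)ᵀ - ((1 - A) * B) * P * (Bᵀ * (1 - A)ᵀ) := by
          rw [conjTranspose_eq_transpose_of_trivial]
          noncomm_ring
      _ = (1 - A) * P * (1 - A)ᵀ - (1 + A) * P * (1 + A)ᵀ := by rw [hB, hB']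
      _ = (2 : ℝ) • -(A * P + P * Aᵀ) := by
          rw [transpose_sub, transpose_add, transpose_one, two_smul]
          noncomm_ring
  rw [hid] at hconj
  simpa [smul_smul] using hconj.smul (show (0 : ℝ) < 2⁻¹ by norm_num)

/-- A positive definite form dominates a small multiple of the square of any linear form. -/
theorem Matrix.PosDef.exists_pos_mul_sq_lt {ι : Type*} [Fintype ι] [DecidableEq ι]
    {Q : Matrix ι ι ℝ} (hQ : Q.PosDef) (w : ι → ℝ) :
    ∃ c : ℝ, 0 < c ∧ ∀ x : ι → ℝ, x ≠ 0 → c * (w ⬝ᵥ x) ^ 2 < x ⬝ᵥ (Q *ᵥ x) := by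
  have hQt : Qᵀ = Q := by simpa using hQ.isHermitian.eq
  set u := Q⁻¹ *ᵥ w
  have hu : Q *ᵥ u = w := by
    rw [mulVec_mulVec, mul_nonsing_inv _ ((isUnit_iff_isUnit_det _).1 hQ.isUnit), one_mulVec]
  have hs : 0 ≤ u ⬝ᵥ w := by
    simpa [hu] using hQ.posSemidef.dotProduct_mulVec_nonneg u
  refine ⟨(1 + u ⬝ᵥ w)⁻¹, by positivity, fun x hx => ?_⟩
  have hxQ : 0 < x ⬝ᵥ (Q *ᵥ x) := by simpa using hQ.dotProduct_mulVec_pos hx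
  rcases eq_or_ne (w ⬝ᵥ x) 0 with ht | ht
  · simpa [ht] using hxQ
  set c := (1 + u ⬝ᵥ w)⁻¹
  have hcpos : 0 < c := by positivity
  have hcs : c * (1 + u ⬝ᵥ w) = 1 := inv_mul_cancel₀ (by positivity)
  have hux : u ⬝ᵥ (Q *ᵥ x) = w ⬝ᵥ x := by
    rw [dotProduct_mulVec, ← mulVec_transpose, hQt, hu]
  have hnn := hQ.posSemidef.dotProduct_mulVec_nonneg (x - (c * (w ⬝ᵥ x)) • u)
  simp only [star_trivial, mulVec_sub, mulVec_smul, hu, sub_dotProduct, dotProduct_sub,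
    smul_dotProduct, dotProduct_smul, smul_eq_mul, hux, dotProduct_comm x w] at hnn
  have hpos : 0 < (c * (w ⬝ᵥ x)) ^ 2 := by positivity
  linear_combination hnn + hpos + c * (w ⬝ᵥ x) ^ 2 * hcs

/-- If `(F, b)` is stabilizable (some row vector `k` makes `F - b k`
Hurwitz), then there is a symmetric positive definite `P` with
`F P + P Fᵀ - 2 b bᵀ` negative definite. -/
theorem exists_lyapunov_solution_of_stabilizable
    (n : ℕ) (hn : 1 ≤ n) (F : Matrix (Fin n) (Fin n) ℝ) (b : Fin n → ℝ)
    (h : ∃ k : Fin n → ℝ, IsHurwitz (F - Matrix.vecMulVec b k)) :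
    ∃ P : Matrix (Fin n) (Fin n) ℝ, P.PosDef ∧
      (-(F * P + P * Fᵀ - (2 : ℝ) • Matrix.vecMulVec b b)).PosDef := by
  obtain ⟨k, hk⟩ := h
  have : NeZero n := ⟨by omega⟩
  obtain ⟨P, hP, hQ⟩ := hk.exists_posDef_lyapunov
  obtain ⟨c, hc, hlt⟩ := hQ.exists_pos_mul_sq_lt (P *ᵥ k)
  have hPt : Pᵀ = P := by simpa using hP.isHermitian.eq
  refine ⟨(2 * c) • P, hP.smul (by positivity), PosDef.of_dotProduct_mulVec_pos ?_ fun x hx => ?_⟩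
  · simp [IsHermitian, hPt, transpose_vecMulVec, add_comm]
  have hx' := hlt x hx
  have hkP : k ⬝ᵥ (P *ᵥ x) = (P *ᵥ k) ⬝ᵥ x := by
    rw [dotProduct_mulVec, ← mulVec_transpose, hPt]
  have hPb : x ⬝ᵥ (P *ᵥ k) = (P *ᵥ k) ⬝ᵥ x := dotProduct_comm _ _
  have hxb : x ⬝ᵥ b = b ⬝ᵥ x := dotProduct_comm _ _
  simp only [neg_mulVec, add_mulVec, sub_mulVec, transpose_sub, transpose_vecMulVec,
    Matrix.sub_mul, Matrix.mul_sub, ← mulVec_mulVec, vecMulVec_mulVec, smul_mulVec, mulVec_smul,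
    dotProduct_neg, dotProduct_add, dotProduct_sub, dotProduct_smul, smul_eq_mul, star_trivial,
    Matrix.mul_smul, Matrix.smul_mul, op_smul_eq_smul, hkP, hPb, hxb] at hx' ⊢
  nlinarith [sq_nonneg (b ⬝ᵥ x - c * ((P *ᵥ k) ⬝ᵥ x)), mul_lt_mul_of_pos_left hx' hc]
end

section
/- Let n ≥ 1 and let F be an n×n real matrix such that every complex eigenvalue λ of F with Re(λ) ≥ 0 has geometric multiplicity 1. Then there exists a column vector b ∈ ℝⁿ such that the pair (F, b) is stabilizable, i.e., there exists a row vector k ∈ ℝⁿ with F − b·k Hurwitz. -/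
open Matrix

open Polynomial


section RankOneUpdate

variable {K V : Type*} [Field K] [AddCommGroup V] [Module K V]

/-- Two endomorphisms which agree on an invariant subspace have polynomials which agree on it. -/
theorem aeval_apply_eq_of_eqOn {f g : Module.End K V} {A : Submodule K V}
    (hA : A ∈ f.invtSubmodule) (hfg : ∀ x ∈ A, g x = f x) (p : K[X]) {x : V} (hx : x ∈ A) :
    aeval g p x = aeval f p x := by
  have hpow : ∀ n : ℕ, (g ^ n) x = (f ^ n) x := by
    intro n
    induction n with
    | zero => simp
    | succ n ih =>
      have hmem : (f ^ n) x ∈ A := by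
        simpa using aeval_apply_smul_mem_of_le_comap hx (X ^ n : K[X]) f hA
      rw [pow_succ', pow_succ', Module.End.mul_apply, Module.End.mul_apply, ih, hfg _ hmem]
  simp only [aeval_eq_sum_range, LinearMap.sum_apply, LinearMap.smul_apply, hpow]

/-- If `f` is cyclic modulo an invariant subspace `A`, then a rank-one update of `f` vanishing on
`A` makes `a` the only eigenvalue on `V ⧸ A`. -/
theorem exists_smulRight_aeval_mem [IsNoetherian K V] (f : Module.End K V) {A : Submodule K V}
    (hA : A ∈ f.invtSubmodule) (v : V)
    (hv : ∀ W ∈ f.invtSubmodule, A ≤ W → v ∈ W → W = ⊤) (a : K) :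
    ∃ (φ : Module.Dual K V) (w : V) (m : ℕ), (∀ x ∈ A, φ x = 0) ∧
      ∀ x, aeval (f - φ.smulRight w) ((X - C a) ^ m) x ∈ A := by
  let W : ℕ → Submodule K V := fun j ↦
    A ⊔ Submodule.span K ((fun i : ℕ ↦ (f ^ i) v) '' Set.Iio j)
  have hWmono : Monotone W := fun i j hij ↦
    sup_le_sup_left (Submodule.span_mono (Set.image_mono (Set.Iio_subset_Iio hij))) _
  have hAW : ∀ j, A ≤ W j := fun j ↦ le_sup_left
  have hpowW : ∀ {i j : ℕ}, i < j → (f ^ i) v ∈ W j := fun {i j} hij ↦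
    Submodule.mem_sup_right (Submodule.subset_span ⟨i, hij, rfl⟩)
  have hWle : ∀ (j : ℕ) (B : Submodule K V), A ≤ B → (∀ i < j, (f ^ i) v ∈ B) → W j ≤ B := by
    intro j B hAB hB
    refine sup_le hAB (Submodule.span_le.2 ?_)
    rintro _ ⟨i, hi, rfl⟩
    exact hB i hi
  have hex : ∃ m, (f ^ m) v ∈ W m := by
    obtain ⟨m, hm⟩ := monotone_stabilizes_iff_noetherian.mpr inferInstance ⟨W, hWmono⟩
    have h : W m = W (m + 1) := hm (m + 1) m.le_succ
    exact ⟨m, h ▸ hpowW m.lt_succ_self⟩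
  classical
  obtain ⟨m, hm, hmin⟩ : ∃ m, (f ^ m) v ∈ W m ∧ ∀ k < m, (f ^ k) v ∉ W k :=
    ⟨Nat.find hex, Nat.find_spec hex, fun k hk ↦ Nat.find_min hex hk⟩
  have hWtop : W m = ⊤ := by
    refine hv _ ?_ (hAW m) ?_
    · refine hWle m _ (hA.trans (Submodule.comap_mono (hAW m))) fun i hi ↦ ?_
      rw [Submodule.mem_comap, ← Module.End.mul_apply, ← pow_succ']
      rcases (Nat.succ_le_of_lt hi).lt_or_eq with h | h
      · exact hpowW h
      · rw [Nat.succ_eq_add_one] at h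
        rwa [h]
    · rcases m.eq_zero_or_pos with rfl | h
      · simpa using hm
      · simpa using hpowW h
  rcases m with _ | k
  · refine ⟨0, 0, 0, by simp, fun x ↦ ?_⟩
    have hAtop : A = ⊤ := by simpa [W] using hWtop
    simp [hAtop]
  obtain ⟨φ₀, hφ₀, hker⟩ := Submodule.exists_le_ker_of_notMem (hmin k k.lt_succ_self)
  let φ : Module.Dual K V := (φ₀ ((f ^ k) v))⁻¹ • φ₀
  have hφ : φ ((f ^ k) v) = 1 := by simp [φ, hφ₀]
  have hφW : ∀ x ∈ W k, φ x = 0 := fun x hx ↦ by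
    have : φ₀ x = 0 := hker hx
    simp [φ, this]
  set q : K[X] := (X - C a) ^ (k + 1) with hq
  have hqmonic : q.Monic := (monic_X_sub_C a).pow _
  have hqdeg : q.natDegree = k + 1 := by simp [hq, natDegree_pow]
  let w := aeval f q v
  let g : Module.End K V := f - φ.smulRight w
  have hgf : ∀ x ∈ W k, g x = f x := fun x hx ↦ by simp [g, hφW x hx]
  have hgpow : ∀ i ≤ k, (g ^ i) v = (f ^ i) v := by
    intro i hi
    induction i with
    | zero => simp
    | succ i ih =>
      rw [pow_succ', pow_succ', Module.End.mul_apply, Module.End.mul_apply, ih (by omega),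
        hgf _ (hpowW hi)]
  have hgq : aeval g q v = 0 := by
    have hg : aeval g q v = (g ^ (k + 1)) v - (f ^ (k + 1)) v + aeval f q v := by
      have hlead : q.coeff (k + 1) = 1 := by rw [← hqdeg]; exact hqmonic
      simp only [aeval_eq_sum_range, hqdeg, Finset.sum_range_succ _ (k + 1), hlead, one_smul,
        LinearMap.add_apply, LinearMap.sum_apply, LinearMap.smul_apply]
      rw [Finset.sum_congr rfl fun i hi ↦ by
        rw [hgpow i (Nat.lt_succ_iff.1 (Finset.mem_range.1 hi))]]
      abel
    have hstep : (g ^ (k + 1)) v = (f ^ (k + 1)) v - w := by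
      rw [pow_succ', Module.End.mul_apply, hgpow k le_rfl, pow_succ', Module.End.mul_apply]
      simp [g, hφ]
    rw [hg, hstep]
    simp [w]
  have hgA : A ∈ g.invtSubmodule := fun x hx ↦ by
    rw [Submodule.mem_comap, hgf x (hAW k hx)]
    exact hA hx
  refine ⟨φ, w, k + 1, fun x hx ↦ hφW x (hAW k hx), fun x ↦ ?_⟩
  suffices h : W (k + 1) ≤ A.comap (aeval g q) from h (hWtop ▸ Submodule.mem_top)
  refine hWle _ _ (fun x hx ↦ aeval_apply_smul_mem_of_le_comap hx q g hgA) fun i hi ↦ ?_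
  have hcomm : Commute (aeval g q) (g ^ i) := by
    simpa using (Commute.all q (X ^ i)).map (aeval g)
  rw [Submodule.mem_comap, ← hgpow i (Nat.lt_succ_iff.1 hi), ← Module.End.mul_apply, hcomm.eq,
    Module.End.mul_apply, hgq, map_zero]
  exact A.zero_mem

end RankOneUpdate

/-- All complex roots of an irreducible real polynomial have the same real part. -/
theorem re_eq_re_of_aeval_eq_zero {p : ℝ[X]} (hp : Irreducible p) {z w : ℂ}
    (hz : aeval z p = 0) (hw : aeval w p = 0) : w.re = z.re := by
  have hdvd : p ∣ minpoly ℝ z := by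
    have hassoc := (minpoly.irreducible (Algebra.IsIntegral.isIntegral z)).associated_of_dvd hp
      (minpoly.dvd ℝ z hz)
    exact hassoc.symm.dvd
  have hquad : minpoly ℝ z ∣ X ^ 2 - C (2 * z.re) * X + C (z.re ^ 2 + z.im ^ 2) := by
    refine minpoly.dvd ℝ z ?_
    apply Complex.ext <;> simp [sq] <;> ring
  have hroot : w ^ 2 - 2 * z.re * w + (z.re ^ 2 + z.im ^ 2) = 0 := by
    simpa [hw] using aeval_eq_zero_of_dvd_aeval_eq_zero (hdvd.trans hquad) hw
  have hre := congrArg Complex.re hroot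
  have him := congrArg Complex.im hroot
  simp [sq, ← Complex.ofReal_mul] at hre him
  by_cases h : w.im = 0
  · rw [h] at hre
    nlinarith [sq_nonneg (w.re - z.re), sq_nonneg z.im]
  · exact mul_left_cancel₀ h (by linarith)

/-- A nonzero real polynomial factors into a part with stable roots and a part with unstable
roots. -/
theorem exists_mul_eq_stable_unstable {p : ℝ[X]} (hp : p ≠ 0) :
    ∃ s u : ℝ[X], p = s * u ∧ (∀ z : ℂ, aeval z s = 0 → z.re < 0) ∧
      ∀ z : ℂ, aeval z u = 0 → 0 ≤ z.re := by
  induction p using UniqueFactorizationMonoid.induction_on_prime with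
  | h₁ => exact absurd rfl hp
  | h₂ x hx =>
    have hne (z : ℂ) : aeval z x ≠ 0 := (hx.map (aeval z)).ne_zero
    refine ⟨x, 1, by simp, fun z hz ↦ absurd hz (hne z), fun z hz ↦ ?_⟩
    simp at hz
  | h₃ x r hx hr ih =>
    obtain ⟨s, u, rfl, hs, hu⟩ := ih hx
    by_cases h : ∀ z : ℂ, aeval z r = 0 → z.re < 0
    · refine ⟨r * s, u, by ring, fun z hz ↦ ?_, hu⟩
      rw [map_mul, mul_eq_zero] at hz
      exact hz.elim (h z) (hs z)
    · push Not at h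
      obtain ⟨z₀, hz₀, hre⟩ := h
      refine ⟨s, r * u, by ring, hs, fun z hz ↦ ?_⟩
      rw [map_mul, mul_eq_zero] at hz
      exact hz.elim (fun hz ↦ by rwa [re_eq_re_of_aeval_eq_zero hr.irreducible hz₀ hz]) (hu z)

section LeftEigenvector

variable {n : ℕ}

theorem finrank_eigenspace_transpose {K : Type*} [Field K] (A : Matrix (Fin n) (Fin n) K) (μ : K) :
    Module.finrank K (Module.End.eigenspace (toLin' Aᵀ) μ) =
      Module.finrank K (Module.End.eigenspace (toLin' A) μ) := by
  have key (B : Matrix (Fin n) (Fin n) K) :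
      (B - μ • 1).rank + Module.finrank K (Module.End.eigenspace (toLin' B) μ) = n := by
    have h : Module.End.eigenspace (toLin' B) μ = LinearMap.ker (B - μ • 1).mulVecLin := by
      ext x
      simp [sub_eq_zero]
    rw [h, Matrix.rank, LinearMap.finrank_range_add_finrank_ker]
    simp
  have h := rank_transpose (A - μ • 1)
  rw [transpose_sub, transpose_smul, transpose_one] at h
  have h₁ := key A
  have h₂ := key Aᵀ
  omega

theorem hasEigenvalue_transpose_iff {K : Type*} [Field K] (A : Matrix (Fin n) (Fin n) K) (μ : K) :
    Module.End.HasEigenvalue (toLin' Aᵀ) μ ↔ Module.End.HasEigenvalue (toLin' A) μ := by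
  rw [Module.End.hasEigenvalue_iff, Module.End.hasEigenvalue_iff, Ne, Ne,
    ← Submodule.finrank_eq_zero, ← Submodule.finrank_eq_zero, finrank_eigenspace_transpose]

theorem linearCombination_toLin'_apply (F : Matrix (Fin n) (Fin n) ℝ) (ξ : Fin n → ℂ)
    (x : Fin n → ℝ) :
    Fintype.linearCombination ℝ ξ (toLin' F x) =
      Fintype.linearCombination ℝ (toLin' (F.map (Complex.ofReal : ℝ → ℂ))ᵀ ξ) x := by
  simp only [Fintype.linearCombination_apply, toLin'_apply, mulVec, dotProduct, transpose_apply,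
    map_apply, Complex.real_smul, Complex.ofReal_sum, Complex.ofReal_mul, Finset.sum_mul,
    Finset.mul_sum]
  rw [Finset.sum_comm]
  exact Finset.sum_congr rfl fun i _ ↦ Finset.sum_congr rfl fun j _ ↦ by ring

theorem linearCombination_aeval_toLin'_apply {F : Matrix (Fin n) (Fin n) ℝ} {ξ : Fin n → ℂ} {μ : ℂ}
    (hξ : toLin' (F.map (Complex.ofReal : ℝ → ℂ))ᵀ ξ = μ • ξ) (p : ℝ[X]) (x : Fin n → ℝ) :
    Fintype.linearCombination ℝ ξ (aeval (toLin' F) p x) =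
      aeval μ p * Fintype.linearCombination ℝ ξ x := by
  have hpow (k : ℕ) : Fintype.linearCombination ℝ ξ ((toLin' F ^ k) x) =
      μ ^ k * Fintype.linearCombination ℝ ξ x := by
    induction k with
    | zero => simp
    | succ k ih =>
      have hsmul (y : Fin n → ℝ) : Fintype.linearCombination ℝ (μ • ξ) y =
          μ * Fintype.linearCombination ℝ ξ y := by
        simp only [Fintype.linearCombination_apply, Finset.mul_sum, Pi.smul_apply, smul_eq_mul,
          mul_smul_comm]
      rw [pow_succ', Module.End.mul_apply, linearCombination_toLin'_apply, hξ, hsmul, ih]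
      ring
  simp only [aeval_eq_sum_range, LinearMap.sum_apply, LinearMap.smul_apply, map_sum, map_smul,
    hpow, Finset.sum_mul, smul_mul_assoc]

theorem aeval_eq_zero_of_linearCombination_eq_zero {F : Matrix (Fin n) (Fin n) ℝ} {ξ : Fin n → ℂ}
    {μ : ℂ} (hξ : Module.End.HasEigenvector (toLin' (F.map (Complex.ofReal : ℝ → ℂ))ᵀ) μ ξ)
    {p : ℝ[X]} (hp : ∀ x, Fintype.linearCombination ℝ ξ (aeval (toLin' F) p x) = 0) :
    aeval μ p = 0 := by
  obtain ⟨i, hi⟩ := Function.ne_iff.1 hξ.2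
  have h := hp (Pi.single i 1)
  rw [linearCombination_aeval_toLin'_apply hξ.apply_eq_smul,
    Fintype.linearCombination_apply_single, one_smul] at h
  exact (mul_eq_zero.1 h).resolve_right hi

/-- A proper invariant subspace of a real matrix is annihilated by a complex left eigenvector. -/
theorem exists_hasEigenvector_transpose_of_ne_top {F : Matrix (Fin n) (Fin n) ℝ}
    {W : Submodule ℝ (Fin n → ℝ)} (hW : W ∈ Module.End.invtSubmodule (toLin' F)) (hne : W ≠ ⊤) :
    ∃ (μ : ℂ) (ξ : Fin n → ℂ),
      Module.End.HasEigenvector (toLin' (F.map (Complex.ofReal : ℝ → ℂ))ᵀ) μ ξ ∧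
        ∀ x ∈ W, Fintype.linearCombination ℝ ξ x = 0 := by
  let T := toLin' (F.map (Complex.ofReal : ℝ → ℂ))ᵀ
  let N : Submodule ℂ (Fin n → ℂ) :=
    { carrier := {ξ | ∀ x ∈ W, Fintype.linearCombination ℝ ξ x = 0}
      zero_mem' := fun x _ ↦ by simp [Fintype.linearCombination_apply]
      add_mem' := fun {ξ η} hξ hη x hx ↦ by
        have h := congrArg₂ (· + ·) (hξ x hx) (hη x hx)
        simpa [Fintype.linearCombination_apply, mul_add, Finset.sum_add_distrib] using h
      smul_mem' := fun c ξ hξ x hx ↦ by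
        have h := congrArg (c * ·) (hξ x hx)
        simpa [Fintype.linearCombination_apply, Finset.mul_sum, mul_left_comm] using h }
  have hTN : ∀ ξ ∈ N, T ξ ∈ N := fun ξ hξ x hx ↦ by
    rw [← linearCombination_toLin'_apply]
    exact hξ _ (hW hx)
  obtain ⟨ψ, hψ, hker⟩ := Submodule.exists_le_ker_of_lt_top W hne.lt_top
  let η : Fin n → ℂ := fun i ↦ (ψ (Pi.single i 1) : ℂ)
  have hη (x : Fin n → ℝ) : Fintype.linearCombination ℝ η x = (ψ x : ℂ) := by
    have h : Fintype.linearCombination ℝ η = Complex.ofRealAm.toLinearMap ∘ₗ ψ :=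
      LinearMap.pi_ext' fun j ↦ LinearMap.ext_ring (by
        simp [η, Fintype.linearCombination_apply_single])
    exact LinearMap.congr_fun h x
  have hηN : η ∈ N := fun x hx ↦ by
    have : ψ x = 0 := hker hx
    rw [hη, this, Complex.ofReal_zero]
  have hη0 : η ≠ 0 := by
    rintro h
    refine hψ (LinearMap.ext fun x ↦ ?_)
    have := hη x
    rw [h] at this
    simpa [Fintype.linearCombination_apply, eq_comm (a := (0 : ℂ))] using this
  have : Nontrivial N := ⟨⟨⟨η, hηN⟩, 0, fun h ↦ hη0 (congrArg Subtype.val h)⟩⟩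
  obtain ⟨μ, hμ⟩ := Module.End.exists_eigenvalue (T.restrict hTN)
  obtain ⟨ξ, hξ⟩ := hμ.exists_hasEigenvector
  refine ⟨μ, ξ, ⟨Module.End.mem_eigenspace_iff.2 ?_, fun h ↦ hξ.2 (Subtype.ext h)⟩, ξ.2⟩
  exact congrArg Subtype.val hξ.apply_eq_smul

/-- A finite family of nonzero complex vectors admits a real vector pairing nontrivially with each
of them. -/
theorem exists_forall_linearCombination_ne_zero {ι : Type*} [Finite ι] {ξ : ι → Fin n → ℂ}
    (hξ : ∀ i, ξ i ≠ 0) :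
    ∃ v : Fin n → ℝ, ∀ i, Fintype.linearCombination ℝ (ξ i) v ≠ 0 := by
  by_contra! h
  obtain ⟨i, hi⟩ := Subspace.exists_eq_top_of_iUnion_eq_univ
    (p := fun i ↦ LinearMap.ker (Fintype.linearCombination ℝ (ξ i)))
    (Set.eq_univ_of_forall fun v ↦ Set.mem_iUnion.2 (h v))
  obtain ⟨j, hj⟩ := Function.ne_iff.1 (hξ i)
  have h0 := LinearMap.congr_fun (LinearMap.ker_eq_top.1 hi) (Pi.single j 1)
  rw [Fintype.linearCombination_apply_single, one_smul] at h0
  exact hj h0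

end LeftEigenvector

/-- If every complex eigenvalue of `F` with nonnegative real part has
geometric multiplicity one, then there is a column vector `b` such that `(F, b)` is
stabilizable, i.e. some row vector `k` makes `F - b k` Hurwitz. -/
theorem exists_stabilizing_vector
    (n : ℕ) (hn : 1 ≤ n) (F : Matrix (Fin n) (Fin n) ℝ)
    (hF : ∀ μ : ℂ,
        Module.End.HasEigenvalue (Matrix.toLin' (F.map (Complex.ofReal : ℝ → ℂ))) μ →
        0 ≤ μ.re → geomMult F μ = 1) :
    ∃ b k : Fin n → ℝ, IsHurwitz (F - Matrix.vecMulVec b k) := by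
  let f : Module.End ℝ (Fin n → ℝ) := toLin' F
  let T : Module.End ℂ (Fin n → ℂ) := toLin' (F.map (Complex.ofReal : ℝ → ℂ))ᵀ
  obtain ⟨s, u, hsu, hs, hu⟩ :=
    exists_mul_eq_stable_unstable (minpoly.ne_zero (Algebra.IsIntegral.isIntegral (R := ℝ) f))
  let A := LinearMap.ker (aeval f s)
  have hA : A ∈ f.invtSubmodule := fun x hx ↦ by
    have hcomm : Commute (aeval f s) f := by simpa using (Commute.all s X).map (aeval f)
    rw [Submodule.mem_comap, LinearMap.mem_ker, ← Module.End.mul_apply, hcomm.eq,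
      Module.End.mul_apply, LinearMap.mem_ker.1 hx, map_zero]
  have huA (x : Fin n → ℝ) : aeval f u x ∈ A := by
    rw [LinearMap.mem_ker, ← Module.End.mul_apply, ← map_mul, ← hsu, minpoly.aeval,
      LinearMap.zero_apply]
  choose ξ hξ using fun μ : T.Eigenvalues ↦
    Module.End.HasEigenvalue.exists_hasEigenvector (f := T) (μ := μ.1) μ.2
  obtain ⟨v, hv⟩ := exists_forall_linearCombination_ne_zero fun μ ↦ (hξ μ).2
  have hcyclic : ∀ W ∈ f.invtSubmodule, A ≤ W → v ∈ W → W = ⊤ := by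
    intro W hW hAW hvW
    by_contra hne
    obtain ⟨μ, η, hη, hηW⟩ := exists_hasEigenvector_transpose_of_ne_top hW hne
    have hμ : T.HasEigenvalue μ := Module.End.hasEigenvalue_of_hasEigenvector hη
    have hre : 0 ≤ μ.re :=
      hu μ (aeval_eq_zero_of_linearCombination_eq_zero hη fun x ↦ hηW _ (hAW (huA x)))
    have hrank : Module.finrank ℂ (T.eigenspace μ) = 1 :=
      (finrank_eigenspace_transpose _ μ).trans (hF μ ((hasEigenvalue_transpose_iff _ μ).1 hμ) hre)
    obtain ⟨c, hc⟩ := exists_smul_eq_of_finrank_eq_one hrank (x := ⟨η, hη.1⟩)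
      (fun h ↦ hη.2 (congrArg Subtype.val h)) ⟨ξ ⟨μ, hμ⟩, (hξ ⟨μ, hμ⟩).1⟩
    have hc' : c • η = ξ ⟨μ, hμ⟩ := congrArg Subtype.val hc
    refine hv ⟨μ, hμ⟩ ?_
    have h := congrArg (c * ·) (hηW v hvW)
    rw [← hc']
    simpa [Fintype.linearCombination_apply, Finset.mul_sum, mul_left_comm] using h
  obtain ⟨φ, w, m, hφ, hq⟩ := exists_smulRight_aeval_mem f hA v hcyclic (-1)
  let k : Fin n → ℝ := fun i ↦ φ (Pi.single i 1)
  have hg : toLin' (F - vecMulVec w k) = f - φ.smulRight w := by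
    refine LinearMap.pi_ext' fun j ↦ LinearMap.ext_ring (funext fun i ↦ ?_)
    simp [f, k, vecMulVec_apply, mul_comm]
  refine ⟨w, k, fun μ hμ ↦ ?_⟩
  obtain ⟨η, hη⟩ := ((hasEigenvalue_transpose_iff _ μ).2 hμ).exists_hasEigenvector
  have hroot : aeval μ (s * (X - C (-1 : ℝ)) ^ m) = 0 := by
    refine aeval_eq_zero_of_linearCombination_eq_zero hη fun x ↦ ?_
    have hsq : aeval (f - φ.smulRight w) (s * (X - C (-1 : ℝ)) ^ m) x = 0 := by
      rw [map_mul, Module.End.mul_apply,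
        aeval_apply_eq_of_eqOn hA (fun y hy ↦ by simp [hφ y hy]) s (hq x)]
      exact hq x
    rw [hg, hsq, map_zero]
  rw [map_mul, mul_eq_zero] at hroot
  refine hroot.elim (hs μ) fun h ↦ ?_
  have hμ1 : μ + 1 = 0 := by
    rw [map_pow] at h
    simpa using eq_zero_of_pow_eq_zero h
  rw [eq_neg_of_add_eq_zero_left hμ1]
  simp
end
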